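/- Suppose bc ≤ 3 and let h be the Coxeter number (h = 2 if bc = 0, h = 3 if bc = 1, h = 4 if bc = 2, h = 6 if bc = 3). Then the rank-2 cluster sequence with trivial coefficients is periodic with period h+2: y_{m+h+2} = y_m for all m ∈ ℤ. -/

import Mathlib

/-- The ambient field: the field of rational functions in two variables over `ℤ`,
i.e. the fraction field of `ℤ[x₁, x₂]`. -/
abbrev ClusterField : Type := FractionRing (MvPolynomial (Fin 2) ℤ)

/-- The two initial cluster variables `x₁, x₂` inside the ambient field. -/
noncomputable def clusterVar (i : Fin 2) : ClusterField :=
  algebraMap (MvPolynomial (Fin 2) ℤ) ClusterField (MvPolynomial.X i)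

theorem per_0_0 {K : Type*} [Field K] (a0 a1 a2 a3 a4 : K)
    (h0 : a0 ≠ 0) (h1 : a1 ≠ 0) (h2 : a2 ≠ 0) (h3 : a3 ≠ 0)
    (r1 : a0 * a2 = a1 ^ 0 + 1)
    (r2 : a1 * a3 = a2 ^ 0 + 1)
    (r3 : a2 * a4 = a3 ^ 0 + 1)
    : a4 = a0 := by
  have e2 : a2 = 2/a0 := by
    apply mul_left_cancel₀ h0
    rw [r1]
    field_simp
    try ring_nf
  have e3 : a3 = 2/a1 := by
    apply mul_left_cancel₀ h1
    rw [r2, e2]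
    field_simp
    try ring_nf
  have e4 : a4 = a0 := by
    apply mul_left_cancel₀ h2
    rw [r3, e3, e2]
    field_simp
    try ring_nf
  exact e4

theorem per_1_1 {K : Type*} [Field K] (a0 a1 a2 a3 a4 a5 : K)
    (h0 : a0 ≠ 0) (h1 : a1 ≠ 0) (h2 : a2 ≠ 0) (h3 : a3 ≠ 0) (h4 : a4 ≠ 0)
    (r1 : a0 * a2 = a1 ^ 1 + 1)
    (r2 : a1 * a3 = a2 ^ 1 + 1)
    (r3 : a2 * a4 = a3 ^ 1 + 1)
    (r4 : a3 * a5 = a4 ^ 1 + 1)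
    : a5 = a0 := by
  have e2 : a2 = (a1+1)/a0 := by
    apply mul_left_cancel₀ h0
    rw [r1]
    field_simp
    try ring_nf
  have e3 : a3 = (a0+a1+1)/(a0*a1) := by
    apply mul_left_cancel₀ h1
    rw [r2, e2]
    field_simp
    try ring_nf
  have e4 : a4 = (a0+1)/a1 := by
    apply mul_left_cancel₀ h2
    rw [r3, e3, e2]
    field_simp
    try ring_nf
  have e5 : a5 = a0 := by
    apply mul_left_cancel₀ h3
    rw [r4, e4, e3]
    field_simp
    try ring_nf
  exact e5

theorem per_1_2 {K : Type*} [Field K] (a0 a1 a2 a3 a4 a5 a6 : K)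
    (h0 : a0 ≠ 0) (h1 : a1 ≠ 0) (h2 : a2 ≠ 0) (h3 : a3 ≠ 0) (h4 : a4 ≠ 0) (h5 : a5 ≠ 0)
    (r1 : a0 * a2 = a1 ^ 1 + 1)
    (r2 : a1 * a3 = a2 ^ 2 + 1)
    (r3 : a2 * a4 = a3 ^ 1 + 1)
    (r4 : a3 * a5 = a4 ^ 2 + 1)
    (r5 : a4 * a6 = a5 ^ 1 + 1)
    : a6 = a0 := by
  have e2 : a2 = (a1+1)/a0 := by
    apply mul_left_cancel₀ h0
    rw [r1]
    field_simp
    try ring_nf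
  have e3 : a3 = ((a1+1)^2+a0^2)/(a0^2*a1) := by
    apply mul_left_cancel₀ h1
    rw [r2, e2]
    field_simp
    try ring_nf
  have e4 : a4 = (a1+1+a0^2)/(a0*a1) := by
    apply mul_left_cancel₀ h2
    rw [r3, e3, e2]
    field_simp
    try ring_nf
  have e5 : a5 = (a0^2+1)/a1 := by
    apply mul_left_cancel₀ h3
    rw [r4, e4, e3]
    field_simp
    try ring_nf
  have e6 : a6 = a0 := by
    apply mul_left_cancel₀ h4
    rw [r5, e5, e4]
    field_simp
    try ring_nf
  exact e6

theorem per_2_1 {K : Type*} [Field K] (a0 a1 a2 a3 a4 a5 a6 : K)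
    (h0 : a0 ≠ 0) (h1 : a1 ≠ 0) (h2 : a2 ≠ 0) (h3 : a3 ≠ 0) (h4 : a4 ≠ 0) (h5 : a5 ≠ 0)
    (r1 : a0 * a2 = a1 ^ 2 + 1)
    (r2 : a1 * a3 = a2 ^ 1 + 1)
    (r3 : a2 * a4 = a3 ^ 2 + 1)
    (r4 : a3 * a5 = a4 ^ 1 + 1)
    (r5 : a4 * a6 = a5 ^ 2 + 1)
    : a6 = a0 := by
  have e2 : a2 = (a1^2+1)/a0 := by
    apply mul_left_cancel₀ h0
    rw [r1]
    field_simp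
    try ring_nf
  have e3 : a3 = (a1^2+1+a0)/(a0*a1) := by
    apply mul_left_cancel₀ h1
    rw [r2, e2]
    field_simp
    try ring_nf
  have e4 : a4 = ((a0+1)^2+a1^2)/(a0*a1^2) := by
    apply mul_left_cancel₀ h2
    rw [r3, e3, e2]
    field_simp
    try ring_nf
  have e5 : a5 = (a0+1)/a1 := by
    apply mul_left_cancel₀ h3
    rw [r4, e4, e3]
    field_simp
    try ring_nf
  have e6 : a6 = a0 := by
    apply mul_left_cancel₀ h4
    rw [r5, e5, e4]
    field_simp
    try ring_nf
  exact e6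

theorem per_1_3 {K : Type*} [Field K] (a0 a1 a2 a3 a4 a5 a6 a7 a8 : K)
    (h0 : a0 ≠ 0) (h1 : a1 ≠ 0) (h2 : a2 ≠ 0) (h3 : a3 ≠ 0) (h4 : a4 ≠ 0) (h5 : a5 ≠ 0) (h6 : a6 ≠ 0) (h7 : a7 ≠ 0)
    (r1 : a0 * a2 = a1 ^ 1 + 1)
    (r2 : a1 * a3 = a2 ^ 3 + 1)
    (r3 : a2 * a4 = a3 ^ 1 + 1)
    (r4 : a3 * a5 = a4 ^ 3 + 1)
    (r5 : a4 * a6 = a5 ^ 1 + 1)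
    (r6 : a5 * a7 = a6 ^ 3 + 1)
    (r7 : a6 * a8 = a7 ^ 1 + 1)
    : a8 = a0 := by
  have e2 : a2 = (a1+1)/a0 := by
    apply mul_left_cancel₀ h0
    rw [r1]
    field_simp
    try ring_nf
  have e3 : a3 = ((a1+1)^3+a0^3)/(a0^3*a1) := by
    apply mul_left_cancel₀ h1
    rw [r2, e2]
    field_simp
    try ring_nf
  have e4 : a4 = ((a1+1)^2+a0^3)/(a0^2*a1) := by
    apply mul_left_cancel₀ h2
    rw [r3, e3, e2]
    field_simp
    try ring_nf
  have e5 : a5 = ((a0^3+1)^2+3*(a0^3+1)*a1+3*a1^2+a1^3)/(a0^3*a1^2) := by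
    apply mul_left_cancel₀ h3
    rw [r4, e4, e3]
    field_simp
    try ring_nf
  have e6 : a6 = (a0^3+1+a1)/(a0*a1) := by
    apply mul_left_cancel₀ h4
    rw [r5, e5, e4]
    field_simp
    try ring_nf
  have e7 : a7 = (a0^3+1)/a1 := by
    apply mul_left_cancel₀ h5
    rw [r6, e6, e5]
    field_simp
    try ring_nf
  have e8 : a8 = a0 := by
    apply mul_left_cancel₀ h6
    rw [r7, e7, e6]
    field_simp
    try ring_nf
  exact e8

theorem per_3_1 {K : Type*} [Field K] (a0 a1 a2 a3 a4 a5 a6 a7 a8 : K)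
    (h0 : a0 ≠ 0) (h1 : a1 ≠ 0) (h2 : a2 ≠ 0) (h3 : a3 ≠ 0) (h4 : a4 ≠ 0) (h5 : a5 ≠ 0) (h6 : a6 ≠ 0) (h7 : a7 ≠ 0)
    (r1 : a0 * a2 = a1 ^ 3 + 1)
    (r2 : a1 * a3 = a2 ^ 1 + 1)
    (r3 : a2 * a4 = a3 ^ 3 + 1)
    (r4 : a3 * a5 = a4 ^ 1 + 1)
    (r5 : a4 * a6 = a5 ^ 3 + 1)
    (r6 : a5 * a7 = a6 ^ 1 + 1)
    (r7 : a6 * a8 = a7 ^ 3 + 1)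
    : a8 = a0 := by
  have e2 : a2 = (a1^3+1)/a0 := by
    apply mul_left_cancel₀ h0
    rw [r1]
    field_simp
    try ring_nf
  have e3 : a3 = (a1^3+1+a0)/(a0*a1) := by
    apply mul_left_cancel₀ h1
    rw [r2, e2]
    field_simp
    try ring_nf
  have e4 : a4 = ((a1^3+1)^2+3*(a1^3+1)*a0+3*a0^2+a0^3)/(a0^2*a1^3) := by
    apply mul_left_cancel₀ h2
    rw [r3, e3, e2]
    field_simp
    try ring_nf
  have e5 : a5 = ((a0+1)^2+a1^3)/(a0*a1^2) := by
    apply mul_left_cancel₀ h3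
    rw [r4, e4, e3]
    field_simp
    try ring_nf
  have e6 : a6 = ((a0+1)^3+a1^3)/(a0*a1^3) := by
    apply mul_left_cancel₀ h4
    rw [r5, e5, e4]
    field_simp
    try ring_nf
  have e7 : a7 = (a0+1)/a1 := by
    apply mul_left_cancel₀ h5
    rw [r6, e6, e5]
    field_simp
    try ring_nf
  have e8 : a8 = a0 := by
    apply mul_left_cancel₀ h6
    rw [r7, e7, e6]
    field_simp
    try ring_nf
  exact e8

def PosElt (z : ClusterField) : Prop :=
  ∃ p q : MvPolynomial (Fin 2) ℤ, 0 < MvPolynomial.eval (fun _ => (1:ℤ)) p ∧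
    0 < MvPolynomial.eval (fun _ => (1:ℤ)) q ∧
    z * algebraMap _ ClusterField q = algebraMap _ ClusterField p

theorem alg_ne {p : MvPolynomial (Fin 2) ℤ} (hp : 0 < MvPolynomial.eval (fun _ => (1:ℤ)) p) :
    algebraMap _ ClusterField p ≠ 0 := by
  intro h0
  have : p = 0 := by
    apply IsFractionRing.injective (MvPolynomial (Fin 2) ℤ) ClusterField
    rw [h0, map_zero]
  simp [this] at hp

theorem PosElt.ne {z : ClusterField} (h : PosElt z) : z ≠ 0 := by
  obtain ⟨p, q, hp, hq, e⟩ := h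
  rintro rfl
  exact alg_ne hp (by rw [← e, zero_mul])

theorem PosElt.one : PosElt 1 := ⟨1, 1, by simp, by simp, by simp⟩

theorem PosElt.var (i : Fin 2) : PosElt (clusterVar i) :=
  ⟨MvPolynomial.X i, 1, by simp, by simp, by simp [clusterVar]⟩

theorem PosElt.add {z w : ClusterField} (hz : PosElt z) (hw : PosElt w) : PosElt (z + w) := by
  obtain ⟨p, q, hp, hq, e⟩ := hz
  obtain ⟨p', q', hp', hq', e'⟩ := hw
  refine ⟨p * q' + p' * q, q * q', ?_, ?_, ?_⟩
  · simp only [map_add, map_mul]; positivity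
  · simp only [map_mul]; positivity
  · simp only [map_add, map_mul, ← e, ← e']; ring

theorem PosElt.mul {z w : ClusterField} (hz : PosElt z) (hw : PosElt w) : PosElt (z * w) := by
  obtain ⟨p, q, hp, hq, e⟩ := hz
  obtain ⟨p', q', hp', hq', e'⟩ := hw
  refine ⟨p * p', q * q', ?_, ?_, ?_⟩
  · simp only [map_mul]; positivity
  · simp only [map_mul]; positivity
  · simp only [map_mul, ← e, ← e']; ring

theorem PosElt.pow {z : ClusterField} (hz : PosElt z) (n : ℕ) : PosElt (z ^ n) := by
  induction n with
  | zero => simpa using PosElt.one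
  | succ k ih => rw [pow_succ]; exact ih.mul hz

theorem PosElt.quot {z w s : ClusterField} (hz : PosElt z) (hs : PosElt s) (e0 : z * w = s) :
    PosElt w := by
  obtain ⟨p, q, hp, hq, e⟩ := hz
  obtain ⟨p', q', hp', hq', e'⟩ := hs
  refine ⟨p' * q, p * q', ?_, ?_, ?_⟩
  · simp only [map_mul]; positivity
  · simp only [map_mul]; positivity
  · simp only [map_mul, ← e, ← e', ← e0]; ring

theorem posElt_all (b c : ℕ) (y : ℤ → ClusterField)
    (hy1 : y 1 = clusterVar 0) (hy2 : y 2 = clusterVar 1)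
    (hodd : ∀ m : ℤ, Odd m → y (m - 1) * y (m + 1) = y m ^ b + 1)
    (heven : ∀ m : ℤ, Even m → y (m - 1) * y (m + 1) = y m ^ c + 1) (m : ℤ) : PosElt (y m) := by
  have hr : ∀ m : ℤ, PosElt (y m) → PosElt (y (m - 1) * y (m + 1)) := by
    intro m hm
    rcases Int.even_or_odd m with h | h
    · rw [heven m h]; exact (hm.pow c).add PosElt.one
    · rw [hodd m h]; exact (hm.pow b).add PosElt.one
  have key : ∀ m : ℤ, PosElt (y m) ∧ PosElt (y (m + 1)) := by
    intro m
    induction m using Int.inductionOn' (b := 1) with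
    | zero => exact ⟨hy1 ▸ PosElt.var 0, by norm_num; exact hy2 ▸ PosElt.var 1⟩
    | succ k _ ih =>
      refine ⟨ih.2, ?_⟩
      have := hr _ ih.2
      rw [add_sub_cancel_right] at this
      exact ih.1.quot this rfl
    | pred k _ ih =>
      rw [sub_add_cancel]
      refine ⟨?_, ih.1⟩
      have := hr _ ih.1
      exact ih.2.quot this (mul_comm _ _)
  exact (key m).1

/-- **Periodicity of cluster variables in rank 2 (finite case).**
If `bc ≤ 3` and `h` is the corresponding Coxeter number, then the rank-2
cluster sequence with trivial coefficients is periodic with period `h + 2`. -/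
theorem cluster_variable_periodicity_rank_two
    (b c : ℕ) (hbc : (0 < b ∧ 0 < c) ∨ (b = 0 ∧ c = 0)) (hfin : b * c ≤ 3)
    (h : ℕ)
    (hh : h = if b * c = 0 then 2 else if b * c = 1 then 3 else if b * c = 2 then 4 else 6)
    (y : ℤ → ClusterField)
    (hy1 : y 1 = clusterVar 0) (hy2 : y 2 = clusterVar 1)
    (hodd : ∀ m : ℤ, Odd m → y (m - 1) * y (m + 1) = y m ^ b + 1)
    (heven : ∀ m : ℤ, Even m → y (m - 1) * y (m + 1) = y m ^ c + 1) :
    ∀ m : ℤ, y (m + h + 2) = y m := by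
  intro m
  have hne : ∀ k, y k ≠ 0 := fun k => (posElt_all b c y hy1 hy2 hodd heven k).ne
  have main : ∀ p q : ℕ, p * q = b * c → ((0 < p ∧ 0 < q) ∨ (p = 0 ∧ q = 0)) →
      (∀ k : ℤ, Odd k → y (m + k - 1) * y (m + k + 1) = y (m + k) ^ p + 1) →
      (∀ k : ℤ, Even k → y (m + k - 1) * y (m + k + 1) = y (m + k) ^ q + 1) →
      y (m + h + 2) = y m := by
    intro p q hpq hpos P Q
    rw [← hpq] at hh hfin
    have hc : (p = 0 ∧ q = 0) ∨ (p = 1 ∧ q = 1) ∨ (p = 1 ∧ q = 2) ∨ (p = 2 ∧ q = 1) ∨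
        (p = 1 ∧ q = 3) ∨ (p = 3 ∧ q = 1) := by
      rcases hpos with ⟨h1, h2⟩ | h0
      · have : p ≤ 3 := by nlinarith
        have : q ≤ 3 := by nlinarith
        interval_cases p <;> interval_cases q <;> omega
      · exact Or.inl h0
    clear hpq hpos hodd heven
    have P1 := P 1 (by decide)
    have P3 := P 3 (by decide)
    have P5 := P 5 (by decide)
    have P7 := P 7 (by decide)
    have P2 := Q 2 (by decide)
    have P4 := Q 4 (by decide)
    have P6 := Q 6 (by decide)
    simp only [add_assoc, add_sub_assoc] at P1 P2 P3 P4 P5 P6 P7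
    norm_num at P1 P2 P3 P4 P5 P6 P7
    rw [add_assoc]
    rcases hc with ⟨rfl, rfl⟩ | ⟨rfl, rfl⟩ | ⟨rfl, rfl⟩ | ⟨rfl, rfl⟩ | ⟨rfl, rfl⟩ | ⟨rfl, rfl⟩
    · norm_num at hh
      subst hh
      norm_num only [Nat.cast_ofNat]
      exact per_0_0 _ _ _ _ _ (hne _) (hne _) (hne _) (hne _) (by simpa using P1) (by simpa using P2) (by simpa using P3)
    · norm_num at hh
      subst hh
      norm_num only [Nat.cast_ofNat]
      exact per_1_1 _ _ _ _ _ _ (hne _) (hne _) (hne _) (hne _) (hne _) (by simpa using P1) (by simpa using P2) (by simpa using P3) (by simpa using P4)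
    · norm_num at hh
      subst hh
      norm_num only [Nat.cast_ofNat]
      exact per_1_2 _ _ _ _ _ _ _ (hne _) (hne _) (hne _) (hne _) (hne _) (hne _) (by simpa using P1) (by simpa using P2) (by simpa using P3) (by simpa using P4) (by simpa using P5)
    · norm_num at hh
      subst hh
      norm_num only [Nat.cast_ofNat]
      exact per_2_1 _ _ _ _ _ _ _ (hne _) (hne _) (hne _) (hne _) (hne _) (hne _) (by simpa using P1) (by simpa using P2) (by simpa using P3) (by simpa using P4) (by simpa using P5)
    · norm_num at hh
      subst hh
      norm_num only [Nat.cast_ofNat]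
      exact per_1_3 _ _ _ _ _ _ _ _ _ (hne _) (hne _) (hne _) (hne _) (hne _) (hne _) (hne _) (hne _) (by simpa using P1) (by simpa using P2) (by simpa using P3) (by simpa using P4) (by simpa using P5) (by simpa using P6) (by simpa using P7)
    · norm_num at hh
      subst hh
      norm_num only [Nat.cast_ofNat]
      exact per_3_1 _ _ _ _ _ _ _ _ _ (hne _) (hne _) (hne _) (hne _) (hne _) (hne _) (hne _) (hne _) (by simpa using P1) (by simpa using P2) (by simpa using P3) (by simpa using P4) (by simpa using P5) (by simpa using P6) (by simpa using P7)
  rcases Int.even_or_odd m with hm | hm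
  · exact main b c rfl hbc (fun k hk => hodd _ (hm.add_odd hk)) (fun k hk => heven _ (hm.add hk))
  · exact main c b (mul_comm _ _) (by tauto) (fun k hk => heven _ (hm.add_odd hk))
      (fun k hk => hodd _ (hm.add_even hk))
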